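/- Let α₁, α₂ ∈ ℝ with α₁ ≠ 0 and 2α₂/(3α₁) ∉ ℤ. Then there exists a constant c > 0, depending only on α₁ and α₂, such that for every k ∈ ℤ and every triple (k₁,k₂,k₃) ∈ D₂(k), one has |Φ(k₁,k₂,k₃)| ≥ c·(max{⟨k₁⟩, ⟨k₂⟩, ⟨k₃⟩})². -/

import Mathlib

open scoped ENNReal

/-- Japanese bracket `⟨x⟩ = 1 + |x|`. -/
noncomputable def jap (x : ℝ) : ℝ := 1 + |x|

/-- The resonance function `Φ(k₁,k₂,k₃)` of the third order dispersion
relation `k ↦ α₁k³ + α₂k²`. -/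
noncomputable def resPhi (α₁ α₂ : ℝ) (k₁ k₂ k₃ : ℤ) : ℝ :=
  (α₁ * ((k₁ : ℝ) + k₂ + k₃) ^ 3 + α₂ * ((k₁ : ℝ) + k₂ + k₃) ^ 2) -
    (α₁ * (k₁ : ℝ) ^ 3 + α₂ * (k₁ : ℝ) ^ 2) +
    (α₁ * (-(k₂ : ℝ)) ^ 3 + α₂ * (-(k₂ : ℝ)) ^ 2) -
    (α₁ * (k₃ : ℝ) ^ 3 + α₂ * (k₃ : ℝ) ^ 2)

/-- Membership in the region `D₂(k)` (with `k = k₁+k₂+k₃` implicit): nonresonant triples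
that are not frequency-balanced. -/
def memD2 (k₁ k₂ k₃ : ℤ) : Prop :=
  (k₁ + k₂) * (k₂ + k₃) ≠ 0 ∧
    ¬((|k₂| ≤ 4 * |k₁| ∧ |k₁| ≤ 4 * |k₂|) ∧ (|k₂| ≤ 4 * |k₃| ∧ |k₃| ≤ 4 * |k₂|))

/-- A non-integer real number stays away from the integers, uniformly with a linear weight. -/
lemma exists_mul_one_add_abs_le_abs_add (β : ℝ) (hβ : ∀ n : ℤ, β ≠ (n : ℝ)) :
    ∃ c : ℝ, 0 < c ∧ ∀ n : ℤ, c * (1 + |(n : ℝ)|) ≤ |(n : ℝ) + β| := by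
  obtain ⟨δ, hδ, hdist⟩ : ∃ δ : ℝ, 0 < δ ∧ ∀ n : ℤ, δ ≤ |(n : ℝ) + β| := by
    refine ⟨|β - round β|, abs_pos.2 (sub_ne_zero.2 (hβ _)), fun n => ?_⟩
    have h := round_le β (-n)
    push_cast at h
    rwa [sub_neg_eq_add, add_comm β] at h
  have hpos : 0 < 1 + |β| + δ := by positivity
  refine ⟨δ / (1 + |β| + δ), by positivity, fun n => ?_⟩
  have hn := hdist n
  have htri : |(n : ℝ)| ≤ |(n : ℝ) + β| + |β| := by
    simpa using abs_sub ((n : ℝ) + β) β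
  rw [div_mul_eq_mul_div, div_le_iff₀ hpos]
  nlinarith [mul_le_mul_of_nonneg_left htri hδ.le,
    mul_le_mul_of_nonneg_right hn (by positivity : 0 ≤ 1 + |β|)]

/-- If `|x|` and `|y|` are not comparable, the product of the pairwise sums of `x`, `y`, `z` is
bounded below by the square of the largest of them. -/
lemma sq_le_mul_abs_add_of_not_comparable {x y z M : ℝ} (hM : 0 ≤ M)
    (hmax : M ≤ |x| ∨ M ≤ |y| ∨ M ≤ |z|) (hxy : 1 ≤ |x + y|) (hyz : 1 ≤ |y + z|)
    (hne : 4 * |y| < |x| ∨ 4 * |x| < |y|) :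
    (1 + M) ^ 2 ≤ 16 * (|x + y| * |y + z| * (1 + |z + x|)) := by
  have tri (u v : ℝ) : |u| ≤ |u + v| + |v| := by simpa using abs_sub (u + v) v
  have h₁ := tri x y
  have h₂ := tri y x
  have h₃ := tri z y
  have h₄ := tri z x
  have h₅ : |x - y| ≤ |z + x| + |y + z| := by
    simpa [add_comm, add_sub_add_left_eq_sub] using abs_sub (z + x) (y + z)
  have h₆ := abs_sub_abs_le_abs_sub x y
  have h₇ := abs_sub_abs_le_abs_sub y x
  rw [abs_sub_comm y x] at h₇
  rw [add_comm y x] at h₂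
  rw [add_comm z y] at h₃
  have hx := abs_nonneg x
  have hy := abs_nonneg y
  have hd := abs_nonneg (z + x)
  generalize |x + y| = a at *
  generalize |y + z| = b at *
  generalize |z + x| = d at *
  by_cases hz : 2 * |x| ≤ |z| ∧ 2 * |y| ≤ |z|
  · have hMz : M ≤ |z| := by rcases hmax with h | h | h <;> linarith
    have hb : 1 + M ≤ 3 * b := by linarith
    have hd' : 1 + M ≤ 2 * (1 + d) := by linarith
    have h := mul_le_mul hb hd' (by linarith) (by linarith)
    have hbd : 0 ≤ b * (1 + d) := by positivity
    nlinarith [mul_le_mul_of_nonneg_right hxy hbd]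
  · have hMa : 3 * M ≤ 8 * a ∧ 3 * M ≤ 8 * (b + d) := by
      rw [not_and_or, not_le, not_le] at hz
      rcases hmax with h | h | h <;> rcases hne with h' | h' <;> rcases hz with h'' | h'' <;>
        constructor <;> linarith
    have ha : 3 * (1 + M) ≤ 11 * a := by linarith
    have hbd : 3 * (1 + M) ≤ 11 * (b * (1 + d)) := by
      nlinarith [mul_nonneg (sub_nonneg.2 hyz) hd]
    have h := mul_le_mul ha hbd (by linarith) (by linarith)
    nlinarith [sq_nonneg (1 + M)]

lemma resPhi_eq_mul (α₁ α₂ : ℝ) (hα₁ : α₁ ≠ 0) (k₁ k₂ k₃ : ℤ) :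
    resPhi α₁ α₂ k₁ k₂ k₃ =
      3 * α₁ * (((k₁ : ℝ) + k₂) * (k₂ + k₃) * (((k₃ + k₁ : ℤ) : ℝ) + 2 * α₂ / (3 * α₁))) := by
  unfold resPhi
  push_cast
  field_simp
  ring

/-- The product of the pairwise sums is bounded below on the unbalanced region. -/
lemma memD2.sq_le_mul_abs_add {k₁ k₂ k₃ : ℤ} (h : memD2 k₁ k₂ k₃) :
    max (jap (k₁ : ℝ)) (max (jap (k₂ : ℝ)) (jap (k₃ : ℝ))) ^ 2 ≤
      16 * (|(k₁ : ℝ) + k₂| * |(k₂ : ℝ) + k₃| * (1 + |(k₃ : ℝ) + k₁|)) := by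
  obtain ⟨hne, hbal⟩ := h
  have h₁₂ : 1 ≤ |(k₁ : ℝ) + k₂| := by
    exact_mod_cast Int.one_le_abs (left_ne_zero_of_mul hne)
  have h₂₃ : 1 ≤ |(k₂ : ℝ) + k₃| := by
    exact_mod_cast Int.one_le_abs (right_ne_zero_of_mul hne)
  simp only [jap, max_add_add_left]
  set M : ℝ := max |(k₁ : ℝ)| (max |(k₂ : ℝ)| |(k₃ : ℝ)|)
  have hM : 0 ≤ M := (abs_nonneg _).trans (le_max_left _ _)
  have hmax : M ≤ |(k₁ : ℝ)| ∨ M ≤ |(k₂ : ℝ)| ∨ M ≤ |(k₃ : ℝ)| := by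
    rw [← le_max_iff, ← le_max_iff]
  have hcases : (4 * |k₂| < |k₁| ∨ 4 * |k₁| < |k₂|) ∨ (4 * |k₂| < |k₃| ∨ 4 * |k₃| < |k₂|) := by
    omega
  rcases hcases with hc | hc
  · exact sq_le_mul_abs_add_of_not_comparable hM hmax h₁₂ h₂₃ (by exact_mod_cast hc)
  · have := sq_le_mul_abs_add_of_not_comparable (x := (k₃ : ℝ)) (y := k₂) (z := k₁) hM
      (by tauto) (by rwa [add_comm]) (by rwa [add_comm]) (by exact_mod_cast hc)
    rwa [add_comm (k₃ : ℝ) k₂, add_comm (k₂ : ℝ) k₁, add_comm (k₁ : ℝ) k₃,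
      mul_comm |(k₂ : ℝ) + k₃|] at this

/-- Lower bound on `Φ` in `D₂(k)` (2.13) / `est:D2`. -/
theorem stmt14 (α₁ α₂ : ℝ) (hα₁ : α₁ ≠ 0)
    (hres : ∀ n : ℤ, 2 * α₂ / (3 * α₁) ≠ (n : ℝ)) :
    ∃ c : ℝ, 0 < c ∧
      ∀ k₁ k₂ k₃ : ℤ, memD2 k₁ k₂ k₃ →
        c * max (jap (k₁ : ℝ)) (max (jap (k₂ : ℝ)) (jap (k₃ : ℝ))) ^ 2 ≤
          |resPhi α₁ α₂ k₁ k₂ k₃| := by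
  obtain ⟨c, hc, hlow⟩ := exists_mul_one_add_abs_le_abs_add _ hres
  have hα : 0 < |α₁| := abs_pos.2 hα₁
  refine ⟨3 * |α₁| * c / 16, by positivity, fun k₁ k₂ k₃ hk => ?_⟩
  have hd := hlow (k₃ + k₁)
  rw [resPhi_eq_mul α₁ α₂ hα₁]
  simp only [abs_mul, Nat.abs_ofNat]
  push_cast at hd ⊢
  calc
    _ ≤ 3 * |α₁| * c / 16 *
        (16 * (|(k₁ : ℝ) + k₂| * |(k₂ : ℝ) + k₃| * (1 + |(k₃ : ℝ) + k₁|))) := by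
      gcongr
      exact hk.sq_le_mul_abs_add
    _ = 3 * |α₁| * (|(k₁ : ℝ) + k₂| * |(k₂ : ℝ) + k₃| * (c * (1 + |(k₃ : ℝ) + k₁|))) := by ring
    _ ≤ _ := by gcongr
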